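/- Fix an integer ν ≥ 1. There exists a constant C = C(ν) > 0 such that for every ε > 0 there exists T₀ with the following property: for every real T ≥ T₀ and every integer h with 3 ≤ h < T, the number of primes p ≤ T for which there exists s ∈ F_p with K_ν(p,h,s) > (h^ν + h^{2ν−1/2}·T^{−1/2})·exp(C·log h/log log h) is at most ε·T/(log T)². -/

import Mathlib

/-- The growth factor `exp (log h / log log h)`. -/
noncomputable def growth (h : ℕ) : ℝ := Real.exp (Real.log h / Real.log (Real.log h))

lemma one_lt_log_of_three_le {h : ℕ} (hh : 3 ≤ h) : 1 < Real.log h := by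
  rw [Real.lt_log_iff_exp_lt (by positivity)]
  have : (3 : ℝ) ≤ h := by exact_mod_cast hh
  linarith [Real.exp_one_lt_d9]

lemma loglog_pos {h : ℕ} (hh : 3 ≤ h) : 0 < Real.log (Real.log h) :=
  Real.log_pos (one_lt_log_of_three_le hh)

lemma sq_log_le_sqrt {L : ℝ} (hL : 1 ≤ L) : Real.log L ^ 2 ≤ 16 * √L := by
  have h0 : 0 ≤ Real.log L := Real.log_nonneg hL
  have h1 := Real.log_le_rpow_div (x := L) (by linarith) (ε := 1 / 4) (by norm_num)
  have h2 : (L ^ (1 / 4 : ℝ)) ^ 2 = √L := by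
    rw [Real.sqrt_eq_rpow, ← Real.rpow_natCast, ← Real.rpow_mul (by linarith)]
    norm_num
  calc Real.log L ^ 2 ≤ (L ^ (1 / 4 : ℝ) / (1 / 4)) ^ 2 := by gcongr
    _ = 16 * (L ^ (1 / 4 : ℝ)) ^ 2 := by ring
    _ = 16 * √L := by rw [h2]

lemma log_le_four_mul_sqrt {L : ℝ} (hL : 1 ≤ L) : Real.log L ≤ 4 * √L := by
  have h0 : 0 ≤ Real.log L := Real.log_nonneg hL
  have h3 : 1 ≤ √L := Real.one_le_sqrt.mpr hL
  have := sq_log_le_sqrt hL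
  nlinarith

lemma exp_one_le_growth {h : ℕ} (hh : 3 ≤ h) : Real.exp 1 ≤ growth h := by
  rw [growth, Real.exp_le_exp, le_div_iff₀ (loglog_pos hh), one_mul]
  have := Real.log_le_sub_one_of_pos (x := Real.log h)
    (by linarith [one_lt_log_of_three_le hh])
  linarith

lemma two_le_growth {h : ℕ} (hh : 3 ≤ h) : 2 ≤ growth h := by
  linarith [exp_one_le_growth hh, Real.exp_one_gt_d9]

lemma one_le_growth {h : ℕ} (hh : 3 ≤ h) : 1 ≤ growth h := by
  linarith [two_le_growth hh]

lemma growth_pos (h : ℕ) : 0 < growth h := Real.exp_pos _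

lemma growth_pow (h D : ℕ) :
    growth h ^ D = Real.exp (D * (Real.log h / Real.log (Real.log h))) := by
  rw [growth, ← Real.exp_nat_mul]

lemma exists_const_le_growth_pow (c : ℝ) :
    ∃ D : ℕ, ∀ h : ℕ, 3 ≤ h → c ≤ growth h ^ D := by
  obtain ⟨D, hD⟩ := pow_unbounded_of_one_lt c (one_lt_two : (1 : ℝ) < 2)
  refine ⟨D, fun h hh ↦ hD.le.trans ?_⟩
  gcongr
  exact two_le_growth hh

lemma log_le_growth_pow {h : ℕ} (hh : 3 ≤ h) : Real.log h ≤ growth h ^ 16 := by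
  have hL := one_lt_log_of_three_le hh
  have hl := loglog_pos hh
  rw [growth_pow, ← Real.log_le_iff_le_exp (by linarith), mul_div_assoc', le_div_iff₀ hl]
  have h1 := sq_log_le_sqrt hL.le
  have h2 : √(Real.log h) ≤ Real.log h := by
    rw [Real.sqrt_le_left (by linarith)]; nlinarith
  push_cast
  nlinarith

/-- The classical divisor bound, uniformly for integers of polynomial size in `h`. -/
lemma exists_card_divisors_le (c : ℕ) :
    ∃ D : ℕ, ∀ h : ℕ, 3 ≤ h → ∀ N : ℕ, N ≠ 0 → N ≤ h ^ c →
      (N.divisors.card : ℝ) ≤ growth h ^ D := by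
  refine ⟨16 + 8 * c + 2 * c, fun h hh N hN hNc ↦ ?_⟩
  have hL := one_lt_log_of_three_le hh
  have hl := loglog_pos hh
  set L := Real.log h with hLdef
  set l := Real.log L with hldef
  have hlogN : Real.log N ≤ c * L := by
    rw [hLdef, ← Real.log_pow]
    apply Real.log_le_log (by positivity)
    exact_mod_cast hNc
  set B : ℝ := (2 * c + 1) * L with hB
  have hB1 : 1 ≤ B := by
    have : (0 : ℝ) ≤ c := by positivity
    nlinarith
  set α : ℝ := 2 * Real.log 2 / l with hα
  have hα0 : 0 ≤ α := by positivity
  have hlog2 : 0.5 < Real.log 2 := by linarith [Real.log_two_gt_d9]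
  have hterm : ∀ q ∈ N.primeFactors, ((N.factorization q + 1 : ℕ) : ℝ) ≤
      (if (q : ℝ) ≤ √L then B else 1) * ((q : ℝ) ^ N.factorization q) ^ α := by
    intro q hq
    have hqp := Nat.prime_of_mem_primeFactors hq
    have hq1 : (1 : ℝ) ≤ q := by exact_mod_cast hqp.one_le
    have hpow1 : (1 : ℝ) ≤ (q : ℝ) ^ N.factorization q := one_le_pow₀ hq1
    split_ifs with hqy
    · have h1 : (1 : ℝ) ≤ ((q : ℝ) ^ N.factorization q) ^ α := Real.one_le_rpow hpow1 hα0
      have h2 : (N.factorization q : ℝ) * Real.log 2 ≤ c * L := by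
        refine le_trans ?_ hlogN
        rw [← Real.log_pow]
        apply Real.log_le_log (by positivity)
        have : 2 ^ N.factorization q ≤ N :=
          (Nat.pow_le_pow_left hqp.two_le _).trans (Nat.ordProj_le q hN)
        exact_mod_cast this
      have h3 : (N.factorization q : ℝ) ≤ 2 * (c * L) := by
        have : (0 : ℝ) ≤ N.factorization q := by positivity
        nlinarith
      push_cast
      calc (N.factorization q : ℝ) + 1 ≤ B := by rw [hB]; linarith
        _ ≤ _ := le_mul_of_one_le_right (by linarith) h1
    · push Not at hqy
      rw [one_mul]
      have h1 : N.factorization q + 1 ≤ 2 ^ N.factorization q := Nat.lt_two_pow_self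
      have h2 : l / 2 ≤ Real.log q := by
        have : Real.log (√L) = l / 2 := by rw [Real.log_sqrt (by linarith)]
        rw [← this]
        exact Real.log_le_log (by positivity) hqy.le
      calc ((N.factorization q + 1 : ℕ) : ℝ) ≤ 2 ^ N.factorization q := by exact_mod_cast h1
        _ = Real.exp (N.factorization q * Real.log 2) := by
          rw [Real.exp_nat_mul, Real.exp_log (by norm_num)]
        _ ≤ Real.exp (Real.log ((q : ℝ) ^ N.factorization q) * α) := by
          rw [Real.exp_le_exp, Real.log_pow, mul_assoc]
          gcongr
          rw [hα, mul_div_assoc', le_div_iff₀ hl]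
          nlinarith
        _ = _ := by rw [Real.rpow_def_of_pos (by linarith)]
  have hprod : (N.divisors.card : ℝ) ≤ B ^ √L * (N : ℝ) ^ α := by
    rw [Nat.card_divisors hN, Nat.cast_prod]
    refine (Finset.prod_le_prod (fun _ _ ↦ by positivity) hterm).trans ?_
    rw [Finset.prod_mul_distrib]
    have e2 : ∏ q ∈ N.primeFactors, ((q : ℝ) ^ N.factorization q) ^ α = (N : ℝ) ^ α := by
      rw [Real.finsetProd_rpow _ _ (fun _ _ ↦ by positivity)]
      congr 1
      conv_rhs => rw [← Nat.prod_factorization_pow_eq_self hN]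
      rw [Finsupp.prod, Nat.support_factorization]
      push_cast
      rfl
    rw [e2]
    gcongr
    rw [Finset.prod_ite, Finset.prod_const, Finset.prod_const_one, mul_one, ← Real.rpow_natCast]
    apply Real.rpow_le_rpow_of_exponent_le hB1
    have : (N.primeFactors.filter fun q : ℕ ↦ (q : ℝ) ≤ √L) ⊆ Finset.Icc 1 ⌊√L⌋₊ := by
      intro q hq
      rw [Finset.mem_filter] at hq
      rw [Finset.mem_Icc]
      exact ⟨(Nat.prime_of_mem_primeFactors hq.1).one_le, Nat.le_floor hq.2⟩
    have hc := Finset.card_le_card this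
    rw [Nat.card_Icc, Nat.add_sub_cancel] at hc
    exact (Nat.cast_le.mpr hc).trans (Nat.floor_le (by positivity))
  refine hprod.trans ?_
  rw [Real.rpow_def_of_pos (by linarith), Real.rpow_def_of_pos (by positivity), ← Real.exp_add,
    growth_pow, Real.exp_le_exp, ← hLdef, ← hldef]
  have hs1 : 1 ≤ √L := Real.one_le_sqrt.mpr hL.le
  have hss : √L * √L = L := Real.mul_self_sqrt (by linarith)
  have i1 : Real.log B ≤ 2 * c + l := by
    rw [hB, Real.log_mul (by positivity) (by linarith), ← hldef]
    have := Real.log_le_sub_one_of_pos (x := 2 * (c : ℝ) + 1) (by positivity)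
    linarith
  have i2 : Real.log B * √L ≤ (16 + 8 * c) * (L / l) := by
    rw [mul_div_assoc', le_div_iff₀ hl]
    have j1 := sq_log_le_sqrt hL.le
    have j2 := log_le_four_mul_sqrt hL.le
    rw [← hldef] at j1 j2
    calc Real.log B * √L * l ≤ (2 * c + l) * √L * l := by gcongr
      _ = (2 * c * l + l ^ 2) * √L := by ring
      _ ≤ (2 * c * (4 * √L) + 16 * √L) * √L := by gcongr
      _ = (16 + 8 * c) * (√L * √L) := by ring
      _ = _ := by rw [hss]
  have i3 : Real.log N * α ≤ 2 * c * (L / l) := by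
    calc Real.log N * α ≤ (c * L) * α := by gcongr
      _ = 2 * c * (L / l) * Real.log 2 := by rw [hα]; ring
      _ ≤ 2 * c * (L / l) * 1 := by
        gcongr
        linarith [Real.log_two_lt_d9]
      _ = _ := by ring
  push_cast
  linarith

section

open Polynomial

/-- The polynomial `∏ (X + x i)`. -/
noncomputable def shiftPoly {n : ℕ} (x : Fin n → ℤ) : ℤ[X] := ∏ i, (X + C (x i))

/-- The polynomial `∏ (X + x i) - ∏ (X + y i)`. -/
noncomputable def diffPoly {n : ℕ} (x y : Fin n → ℤ) : ℤ[X] := shiftPoly x - shiftPoly y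

/-- The integer points of `[1, h] ^ n`. -/
noncomputable def box (n h : ℕ) : Finset (Fin n → ℤ) := Fintype.piFinset fun _ ↦ Finset.Icc 1 (h : ℤ)

lemma mem_box {n h : ℕ} {x : Fin n → ℤ} : x ∈ box n h ↔ ∀ i, 1 ≤ x i ∧ x i ≤ h := by
  simp [box]

lemma card_box (n h : ℕ) : (box n h).card = h ^ n := by
  simp [box]

/-- Two integer polynomials have a common divisor of positive degree. -/
def ShareFactor (f g : ℤ[X]) : Prop := ∃ Q : ℤ[X], Q.natDegree ≠ 0 ∧ Q ∣ f ∧ Q ∣ g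

lemma natDegree_shiftPoly {n : ℕ} (x : Fin n → ℤ) : (shiftPoly x).natDegree = n := by
  rw [shiftPoly, natDegree_prod_of_monic _ _ fun i _ ↦ monic_X_add_C (x i)]
  simp only [natDegree_X_add_C]
  simp

lemma natDegree_diffPoly_le {n : ℕ} (x y : Fin n → ℤ) : (diffPoly x y).natDegree ≤ n := by
  refine (natDegree_sub_le _ _).trans ?_
  simp [natDegree_shiftPoly]

lemma eval_shiftPoly {n : ℕ} (x : Fin n → ℤ) (a : ℤ) :
    (shiftPoly x).eval a = ∏ i, (a + x i) := by
  simp [shiftPoly, eval_prod]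

lemma taylor_shiftPoly {n : ℕ} (x : Fin n → ℤ) (t : ℤ) :
    taylor t (shiftPoly x) = shiftPoly fun i ↦ x i + t := by
  change taylorAlgHom t (shiftPoly x) = _
  rw [shiftPoly, shiftPoly, map_prod]
  refine Finset.prod_congr rfl fun i _ ↦ ?_
  simp only [taylorAlgHom_apply, map_add, taylor_X, taylor_C]
  ring

lemma taylor_diffPoly {n : ℕ} (x y : Fin n → ℤ) (t : ℤ) :
    taylor t (diffPoly x y) = diffPoly (fun i ↦ x i + t) fun i ↦ y i + t := by
  rw [diffPoly, map_sub, taylor_shiftPoly, taylor_shiftPoly, diffPoly]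

lemma ShareFactor.of_taylor {f g : ℤ[X]} {t : ℤ} (H : ShareFactor (taylor t f) (taylor t g)) :
    ShareFactor f g := by
  obtain ⟨Q, hQ, h1, h2⟩ := H
  refine ⟨taylor (-t) Q, by rwa [natDegree_taylor], ?_, ?_⟩
  · simpa [taylor_taylor] using map_dvd (taylorAlgHom (-t)) h1
  · simpa [taylor_taylor] using map_dvd (taylorAlgHom (-t)) h2

lemma coeff_prod_X_add_C_bounds {ι : Type*} (s : Finset ι) (x : ι → ℤ) (H : ℤ)
    (hx : ∀ i ∈ s, 0 ≤ x i ∧ x i ≤ H) (k : ℕ) :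
    0 ≤ (∏ i ∈ s, (X + C (x i))).coeff k ∧
      (∏ i ∈ s, (X + C (x i))).coeff k ≤ (1 + H) ^ s.card := by
  classical
  induction s using Finset.induction_on generalizing k with
  | empty =>
    simp only [Finset.prod_empty, Finset.card_empty, pow_zero, coeff_one]
    split_ifs <;> simp
  | insert a s ha ih =>
    have ih' := fun k ↦ ih (fun i hi ↦ hx i (Finset.mem_insert_of_mem hi)) k
    have hxa := hx a (Finset.mem_insert_self _ _)
    have hM := (ih' 0).1.trans (ih' 0).2
    rw [Finset.prod_insert ha, Finset.card_insert_of_notMem ha, add_mul, coeff_add, coeff_C_mul,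
      pow_succ]
    have h2 : x a * (∏ i ∈ s, (X + C (x i))).coeff k ≤ H * (1 + H) ^ s.card :=
      mul_le_mul hxa.2 (ih' k).2 (ih' k).1 (hxa.1.trans hxa.2)
    have h3 : 0 ≤ x a * (∏ i ∈ s, (X + C (x i))).coeff k := mul_nonneg hxa.1 (ih' k).1
    rcases k with _ | k
    · simp only [coeff_X_mul_zero]
      constructor <;> nlinarith
    · rw [coeff_X_mul]
      have := ih' k
      constructor <;> nlinarith

lemma abs_coeff_diffPoly_le {n h : ℕ} {x y : Fin n → ℤ} (hx : x ∈ box n h) (hy : y ∈ box n h)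
    (k : ℕ) : |(diffPoly x y).coeff k| ≤ (1 + h : ℤ) ^ n := by
  rw [mem_box] at hx hy
  have h1 := coeff_prod_X_add_C_bounds Finset.univ x h
    (fun i _ ↦ ⟨by linarith [(hx i).1], (hx i).2⟩) k
  have h2 := coeff_prod_X_add_C_bounds Finset.univ y h
    (fun i _ ↦ ⟨by linarith [(hy i).1], (hy i).2⟩) k
  rw [Finset.card_univ, Fintype.card_fin] at h1 h2
  rw [diffPoly, coeff_sub, shiftPoly, shiftPoly, abs_le]
  constructor <;> linarith

lemma abs_resultant_le {f g : ℤ[X]} {n : ℕ} {M : ℤ} (hM : 1 ≤ M) (hf : f.natDegree ≤ n)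
    (hg : g.natDegree ≤ n) (hfM : ∀ k, |f.coeff k| ≤ M) (hgM : ∀ k, |g.coeff k| ≤ M) :
    |resultant f g| ≤ (2 * n).factorial * M ^ (2 * n) := by
  have hentry : ∀ i j, AbsoluteValue.abs (sylvester f g f.natDegree g.natDegree i j) ≤ M := by
    intro i j
    have h0 : |(0 : ℤ)| ≤ M := by simp; linarith
    induction j using Fin.addCases <;> simp only [sylvester, Matrix.of_apply, Fin.addCases_left,
      Fin.addCases_right, AbsoluteValue.abs_apply] <;> split_ifs <;>
      first | exact hgM _ | exact hfM _ | exact h0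
  have := Matrix.det_le hentry
  rw [Fintype.card_fin, AbsoluteValue.abs_apply] at this
  refine this.trans ?_
  rw [nsmul_eq_mul]
  have hle : f.natDegree + g.natDegree ≤ 2 * n := by omega
  have h1 : ((f.natDegree + g.natDegree).factorial : ℤ) ≤ (2 * n).factorial := by
    exact_mod_cast Nat.factorial_le hle
  have h2 : M ^ (f.natDegree + g.natDegree) ≤ M ^ (2 * n) := pow_le_pow_right₀ hM hle
  gcongr

lemma dvd_resultant_of_common_root {p : ℕ} {f g : ℤ[X]} (hf : f.natDegree ≠ 0) {s : ZMod p}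
    (hfs : (f.map (Int.castRingHom (ZMod p))).eval s = 0)
    (hgs : (g.map (Int.castRingHom (ZMod p))).eval s = 0) :
    (p : ℤ) ∣ resultant f g := by
  obtain ⟨u, v, -, -, huv⟩ := exists_mul_add_mul_eq_C_resultant f g le_rfl le_rfl (Or.inl hf)
  have := congrArg (fun P ↦ (P.map (Int.castRingHom (ZMod p))).eval s) huv
  simp only [Polynomial.map_add, Polynomial.map_mul, eval_add, eval_mul, hfs, hgs, zero_mul,
    add_zero] at this
  rw [map_C, eval_C, eq_intCast] at this
  exact (ZMod.intCast_zmod_eq_zero_iff_dvd _ _).mp this.symm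

lemma resultant_ne_zero_of_not_shareFactor {f g : ℤ[X]} (hf : f ≠ 0) (H : ¬ ShareFactor f g) :
    resultant f g ≠ 0 := by
  intro hres
  apply H
  have hinj : Function.Injective (Int.castRingHom ℚ) := Int.cast_injective
  have hresQ : resultant (f.map (Int.castRingHom ℚ)) (g.map (Int.castRingHom ℚ)) = 0 := by
    rw [natDegree_map_eq_of_injective hinj, natDegree_map_eq_of_injective hinj,
      resultant_map_map, hres, map_zero]
  have hnc := (resultant_eq_zero_iff.mp hresQ).2
  have hfQ : f.map (Int.castRingHom ℚ) ≠ 0 := (Polynomial.map_ne_zero_iff hinj).mpr hf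
  obtain ⟨d, hd, hdf, hdg⟩ : ∃ d : ℚ[X], Irreducible d ∧ d ∣ f.map (Int.castRingHom ℚ) ∧
      d ∣ g.map (Int.castRingHom ℚ) := by
    by_contra! hcon
    exact hnc (isCoprime_of_irreducible_dvd (fun h ↦ hfQ h.1) hcon)
  obtain ⟨b, hb, hbe⟩ := IsLocalization.integerNormalization_spec (nonZeroDivisors ℤ) d
  set e := IsLocalization.integerNormalization (nonZeroDivisors ℤ) d with he
  have hb0 : b ≠ 0 := nonZeroDivisors.ne_zero hb
  have hemap : e.map (Int.castRingHom ℚ) = C (b : ℚ) * d := by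
    rw [← smul_eq_C_mul, Int.cast_smul_eq_zsmul]
    exact hbe
  have hunit : IsUnit (C (b : ℚ)) := isUnit_C.mpr (IsUnit.mk0 _ (by exact_mod_cast hb0))
  have hprim := isPrimitive_primPart e
  have hQe : e.primPart.map (Int.castRingHom ℚ) ∣ e.map (Int.castRingHom ℚ) :=
    Polynomial.map_dvd _ (primPart_dvd e)
  refine ⟨e.primPart, ?_, ?_, ?_⟩
  · rw [natDegree_primPart, ← natDegree_map_eq_of_injective hinj, hemap,
      natDegree_C_mul (by exact_mod_cast hb0)]
    exact hd.natDegree_pos.ne'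
  · rw [IsPrimitive.Int.dvd_iff_map_cast_dvd_map_cast _ _ hprim]
    refine hQe.trans ?_
    rwa [hemap, hunit.mul_left_dvd]
  · rw [IsPrimitive.Int.dvd_iff_map_cast_dvd_map_cast _ _ hprim]
    refine hQe.trans ?_
    rwa [hemap, hunit.mul_left_dvd]

/-- Integer factors of an integer polynomial have controlled values. -/
lemma abs_eval_factor_le {f Q : ℤ[X]} {n : ℕ} {M A a : ℤ} (hf : f ≠ 0) (hQ : Q ∣ f)
    (hn : f.natDegree ≤ n) (hM : ∀ k, |f.coeff k| ≤ M) (hA : 1 ≤ A) (ha : |a| ≤ A) :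
    |Q.eval a| ≤ (n + 1) * (2 ^ n * ((n + 1) * M) * A ^ n) := by
  obtain ⟨R, rfl⟩ := hQ
  have hQ0 : Q ≠ 0 := left_ne_zero_of_mul hf
  have hR0 : R ≠ 0 := right_ne_zero_of_mul hf
  have hinj : Function.Injective (Int.castRingHom ℂ) := Int.cast_injective
  have hdeg : Q.natDegree ≤ n := (natDegree_le_of_dvd (dvd_mul_right Q R) hf).trans hn
  have hM0 : 0 ≤ M := (abs_nonneg _).trans (hM 0)
  have hmahler : ((Q * R).map (Int.castRingHom ℂ)).mahlerMeasure ≤ ((n + 1) * M : ℝ) := by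
    refine (mahlerMeasure_le_sum_norm_coeff _).trans ?_
    rw [sum_over_range' _ (fun _ ↦ norm_zero) (n + 1)
      (by rw [natDegree_map_eq_of_injective hinj]; omega)]
    refine (Finset.sum_le_card_nsmul _ _ (M : ℝ) fun k _ ↦ ?_).trans (by simp)
    rw [coeff_map, eq_intCast, Complex.norm_intCast]
    exact_mod_cast hM k
  have hcoeff : ∀ k, |Q.coeff k| ≤ 2 ^ n * ((n + 1) * M) := by
    intro k
    have h1 := norm_coeff_le_choose_mul_mahlerMeasure_of_one_le_mahlerMeasure k
      (Q.map (Int.castRingHom ℂ)) (R.map (Int.castRingHom ℂ))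
      (one_le_mahlerMeasure_of_ne_zero hR0)
    rw [← Polynomial.map_mul, coeff_map, eq_intCast, Complex.norm_intCast,
      natDegree_map_eq_of_injective hinj] at h1
    have h2 : (Q.natDegree.choose k : ℝ) ≤ 2 ^ n := by
      have : Q.natDegree.choose k ≤ 2 ^ n :=
        (Nat.choose_le_two_pow _ _).trans (Nat.pow_le_pow_right (by norm_num) hdeg)
      exact_mod_cast this
    have h3 : (|Q.coeff k| : ℝ) ≤ 2 ^ n * ((n + 1) * M) := by
      refine h1.trans ?_
      have := mahlerMeasure_nonneg ((Q * R).map (Int.castRingHom ℂ))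
      gcongr
    exact_mod_cast h3
  rw [eval_eq_sum_range' (n := n + 1) (by omega)]
  refine (Finset.abs_sum_le_sum_abs _ _).trans ?_
  refine (Finset.sum_le_card_nsmul _ _ (2 ^ n * ((n + 1) * M) * A ^ n) fun k hk ↦ ?_).trans
    (by simp)
  rw [abs_mul, abs_pow]
  have hk' : k ≤ n := by simpa [Nat.lt_succ_iff] using hk
  have : |a| ^ k ≤ A ^ n :=
    (pow_le_pow_left₀ (abs_nonneg _) ha k).trans (pow_le_pow_right₀ hA hk')
  gcongr
  exact hcoeff k

lemma eval_dvd_prod_eval {n : ℕ} {Q : ℤ[X]} {x y : Fin n → ℤ} (hQ : Q ∣ diffPoly x y)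
    (i : Fin n) : Q.eval (-x i) ∣ ∏ j, Q.eval (-y j) := by
  have hres : ∀ z : Fin n → ℤ, resultant Q (shiftPoly z) Q.natDegree n =
      ∏ i, ((-1) ^ Q.natDegree * Q.eval (-z i)) := by
    intro z
    have h1 := resultant_prod_right Finset.univ Q (fun i ↦ X + C (z i)) Q.natDegree le_rfl
      (by simp only [leadingCoeff_X_add_C]; simp)
    have h2 : (∏ i, (X + C (z i))).natDegree = n := natDegree_shiftPoly z
    rw [h2] at h1
    rw [shiftPoly, h1]
    refine Finset.prod_congr rfl fun i _ ↦ ?_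
    rw [natDegree_X_add_C, resultant_X_add_C_right _ _ _ le_rfl]
  have heq : resultant Q (shiftPoly x) Q.natDegree n = resultant Q (shiftPoly y) Q.natDegree n := by
    obtain ⟨R, hR⟩ := hQ
    have hx : shiftPoly x = shiftPoly y + Q * R := by rw [← hR, diffPoly]; ring
    rw [hx]
    by_cases hR0 : Q * R = 0
    · rw [hR0, add_zero]
    · apply resultant_add_mul_right _ _ _ _ _ _ le_rfl
      rw [add_comm, ← natDegree_mul (left_ne_zero_of_mul hR0) (right_ne_zero_of_mul hR0), ← hR]
      exact natDegree_diffPoly_le x y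
  rw [hres, hres, Finset.prod_mul_distrib, Finset.prod_mul_distrib] at heq
  have heq' := mul_left_cancel₀ (by simp) heq
  rw [← heq']
  exact Finset.dvd_prod_of_mem _ (Finset.mem_univ i)

lemma card_eval_dvd_le {Q : ℤ[X]} (hQ : Q.natDegree ≠ 0) {N : ℤ} (hN : N ≠ 0) (S : Finset ℤ) :
    (S.filter fun a ↦ Q.eval (-a) ∣ N).card ≤ 2 * Q.natDegree * N.natAbs.divisors.card := by
  classical
  refine Finset.card_le_mul_card_image_of_maps_to (f := fun a ↦ (Q.eval (-a)).natAbs)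
    (fun a ha ↦ ?_) _ fun e _ ↦ ?_
  · rw [Finset.mem_filter] at ha
    rw [Nat.mem_divisors]
    exact ⟨Int.natAbs_dvd_natAbs.mpr ha.2, by simpa using hN⟩
  · have hroots : ∀ v : ℤ, (((Q - C v).roots.toFinset).image fun r ↦ -r).card ≤ Q.natDegree := by
      intro v
      refine Finset.card_image_le.trans ((Multiset.toFinset_card_le _).trans ?_)
      exact (card_roots' _).trans (by rw [natDegree_sub_C])
    have hne : ∀ v : ℤ, Q - C v ≠ 0 := by
      intro v h
      apply hQ
      rw [← natDegree_sub_C (a := v), h, natDegree_zero]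
    refine (Finset.card_le_card (t := (((Q - C (e : ℤ)).roots.toFinset).image fun r ↦ -r) ∪
      (((Q - C (-e : ℤ)).roots.toFinset).image fun r ↦ -r)) fun a ha ↦ ?_).trans
      ((Finset.card_union_le _ _).trans ?_)
    · simp only [Finset.mem_filter] at ha
      simp only [Finset.mem_union, Finset.mem_image, Multiset.mem_toFinset, mem_roots (hne _),
        IsRoot, eval_sub, eval_C]
      rcases Int.natAbs_eq (Q.eval (-a)) with h | h
      · exact Or.inl ⟨-a, by rw [h, ha.2]; ring, by ring⟩
      · exact Or.inr ⟨-a, by rw [h, ha.2]; ring, by ring⟩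
    · linarith [hroots e, hroots (-e)]

section
open UniqueFactorizationMonoid

lemma exists_mem_normalizedFactors_of_dvd {f Q : ℤ[X]} (hf : f ≠ 0) (hQ : Q.natDegree ≠ 0)
    (hQf : Q ∣ f) : ∃ q ∈ normalizedFactors f, q.natDegree ≠ 0 ∧ q ∣ Q := by
  have hQ0 : Q ≠ 0 := by rintro rfl; simp at hQ
  by_contra! hcon
  apply hQ
  rw [← natDegree_eq_of_degree_eq (degree_eq_degree_of_associated (prod_normalizedFactors hQ0)),
    natDegree_multiset_prod _ (zero_notMem_normalizedFactors Q), Multiset.sum_eq_zero_iff]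
  intro d hd
  obtain ⟨q, hq, rfl⟩ := Multiset.mem_map.mp hd
  by_contra hq0
  exact hcon q (Multiset.mem_of_le
    ((dvd_iff_normalizedFactors_le_normalizedFactors hQ0 hf).mp hQf) hq) hq0
    (dvd_of_mem_normalizedFactors hq)

/-- The irreducible factors of positive degree. -/
noncomputable def posFactors (f : ℤ[X]) : Finset ℤ[X] :=
  (normalizedFactors f).toFinset.filter fun q ↦ q.natDegree ≠ 0

lemma card_posFactors_le {f : ℤ[X]} (hf : f ≠ 0) : (posFactors f).card ≤ f.natDegree := by
  calc (posFactors f).card = ∑ q ∈ posFactors f, 1 := by simp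
    _ ≤ ∑ q ∈ posFactors f, q.natDegree := Finset.sum_le_sum fun q hq ↦
      Nat.one_le_iff_ne_zero.mpr (Finset.mem_filter.mp hq).2
    _ ≤ ∑ q ∈ (normalizedFactors f).toFinset, q.natDegree :=
      Finset.sum_le_sum_of_subset (Finset.filter_subset _ _)
    _ ≤ ((normalizedFactors f).map natDegree).sum := by
      rw [Finset.sum_multiset_map_count]
      refine Finset.sum_le_sum fun q hq ↦ ?_
      rw [smul_eq_mul]
      exact Nat.le_mul_of_pos_left _ (Multiset.count_pos.mpr (Multiset.mem_toFinset.mp hq))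
    _ = f.natDegree := by
      rw [← natDegree_multiset_prod _ (zero_notMem_normalizedFactors f)]
      exact natDegree_eq_of_degree_eq (degree_eq_degree_of_associated (prod_normalizedFactors hf))

end

open Classical in
/-- Few pairs of tuples have a difference polynomial sharing a factor with a fixed one. -/
lemma exists_card_shareFactor_le (n : ℕ) :
    ∃ D : ℕ, ∀ h : ℕ, 3 ≤ h → ∀ f : ℤ[X], f ≠ 0 → f.natDegree ≤ n →
      (∀ k, |f.coeff k| ≤ (1 + h : ℤ) ^ n) →
      (((box n h ×ˢ box n h).filter fun xy ↦ (∀ i j, xy.1 i ≠ xy.2 j) ∧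
        ShareFactor f (diffPoly xy.1 xy.2)).card : ℝ) ≤ (h : ℝ) ^ n * growth h ^ D := by
  set k := (n + 1) ^ 2 * 2 ^ n with hk
  obtain ⟨D₀, hD₀⟩ := exists_card_divisors_le ((k + 3 * n) * n)
  obtain ⟨D₁, hD₁⟩ := exists_const_le_growth_pow (n * (2 * n) ^ n)
  refine ⟨D₁ + D₀ * n, fun h hh f hf hfn hfM ↦ ?_⟩
  set t : ℕ := ⌊growth h ^ D₀⌋₊ with ht
  set V : ℤ[X] → (Fin n → ℤ) → Finset (Fin n → ℤ) := fun Q y ↦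
    if ∏ j, Q.eval (-y j) = 0 then ∅ else
      Fintype.piFinset fun _ ↦ (Finset.Icc 1 (h : ℤ)).filter fun a ↦
        Q.eval (-a) ∣ ∏ j, Q.eval (-y j) with hV
  have hNbound : ∀ Q ∈ posFactors f, ∀ y ∈ box n h,
      (∏ j, Q.eval (-y j)).natAbs ≤ h ^ ((k + 3 * n) * n) := by
    intro Q hQ y hy
    rw [mem_box] at hy
    have hQf : Q ∣ f := UniqueFactorizationMonoid.dvd_of_mem_normalizedFactors
      (Multiset.mem_toFinset.mp (Finset.mem_filter.mp hQ).1)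
    have h1 : ∀ j, |Q.eval (-y j)| ≤ (h : ℤ) ^ (k + 3 * n) := by
      intro j
      refine (abs_eval_factor_le hf hQf hfn hfM (A := h) (by exact_mod_cast (by omega : 1 ≤ h))
        (by rw [abs_neg, abs_of_nonneg (by linarith [(hy j).1])]; exact (hy j).2)).trans ?_
      have e1 : k ≤ h ^ k := (Nat.lt_pow_self (by omega)).le
      have e2 : (1 + h) ^ n ≤ (h ^ 2) ^ n := Nat.pow_le_pow_left (by nlinarith) n
      have : (n + 1) * (2 ^ n * ((n + 1) * (1 + h) ^ n) * h ^ n) ≤ h ^ (k + 3 * n) := by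
        calc (n + 1) * (2 ^ n * ((n + 1) * (1 + h) ^ n) * h ^ n)
            = k * (1 + h) ^ n * h ^ n := by rw [hk]; ring
          _ ≤ h ^ k * (h ^ 2) ^ n * h ^ n := by gcongr
          _ = _ := by ring
      exact_mod_cast this
    have h2 : |∏ j, Q.eval (-y j)| ≤ ((h : ℤ) ^ (k + 3 * n)) ^ n := by
      rw [Finset.abs_prod]
      refine (Finset.prod_le_prod (fun _ _ ↦ abs_nonneg _) fun j _ ↦ h1 j).trans ?_
      simp
    rw [Int.abs_eq_natAbs, ← pow_mul] at h2
    exact_mod_cast h2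
  have hVcard : ∀ Q ∈ posFactors f, ∀ y ∈ box n h, (V Q y).card ≤ (2 * n * t) ^ n := by
    intro Q hQ y hy
    have hQf : Q ∣ f := UniqueFactorizationMonoid.dvd_of_mem_normalizedFactors
      (Multiset.mem_toFinset.mp (Finset.mem_filter.mp hQ).1)
    simp only [hV]
    split_ifs with h0
    · simp
    · rw [Fintype.card_piFinset, Finset.prod_const, Finset.card_univ, Fintype.card_fin]
      refine Nat.pow_le_pow_left ?_ n
      refine (card_eval_dvd_le (Finset.mem_filter.mp hQ).2 h0 _).trans ?_
      have h1 : Q.natDegree ≤ n := (natDegree_le_of_dvd hQf hf).trans hfn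
      have h2 : (∏ j, Q.eval (-y j)).natAbs.divisors.card ≤ t :=
        Nat.le_floor (hD₀ h hh _ (by simpa using h0) (hNbound Q hQ y hy))
      gcongr
  have hsub : ((box n h ×ˢ box n h).filter fun xy ↦ (∀ i j, xy.1 i ≠ xy.2 j) ∧
      ShareFactor f (diffPoly xy.1 xy.2)) ⊆
      (posFactors f).biUnion fun Q ↦ (box n h).biUnion fun y ↦ (V Q y).image fun x ↦ (x, y) := by
    rintro ⟨x, y⟩ hxy
    simp only [Finset.mem_filter, Finset.mem_product] at hxy
    obtain ⟨⟨hx, hy⟩, hne, Q₀, hQ₀, hQ₀f, hQ₀g⟩ := hxy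
    obtain ⟨Q, hQ, hQd, hQQ⟩ := exists_mem_normalizedFactors_of_dvd hf hQ₀ hQ₀f
    have hQg : Q ∣ diffPoly x y := hQQ.trans hQ₀g
    simp only [Finset.mem_biUnion, Finset.mem_image]
    refine ⟨Q, Finset.mem_filter.mpr ⟨Multiset.mem_toFinset.mpr hQ, hQd⟩, y, hy, x, ?_, rfl⟩
    simp only [hV]
    rw [if_neg]
    · rw [Fintype.mem_piFinset]
      intro i
      rw [Finset.mem_filter, Finset.mem_Icc]
      exact ⟨mem_box.mp hx i, eval_dvd_prod_eval hQg i⟩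
    · rw [Finset.prod_eq_zero_iff]
      rintro ⟨j, -, hj⟩
      have h1 : (diffPoly x y).eval (-y j) = 0 := eval_eq_zero_of_dvd_of_eval_eq_zero hQg hj
      rw [diffPoly, eval_sub, eval_shiftPoly, eval_shiftPoly,
        Finset.prod_eq_zero (f := fun i ↦ -y j + y i) (Finset.mem_univ j) (by ring), sub_zero,
        Finset.prod_eq_zero_iff] at h1
      obtain ⟨i, -, hi⟩ := h1
      exact hne i j (by linarith)
  have hcard := (Finset.card_le_card hsub).trans
    (Finset.card_biUnion_le_card_mul _ _ (h ^ n * (2 * n * t) ^ n) fun Q hQ ↦ by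
      rw [← card_box n h]
      exact Finset.card_biUnion_le_card_mul _ _ _ fun y hy ↦
        Finset.card_image_le.trans (hVcard Q hQ y hy))
  have hcard' := hcard.trans (Nat.mul_le_mul_right _ ((card_posFactors_le hf).trans hfn))
  have ht' : (t : ℝ) ≤ growth h ^ D₀ := Nat.floor_le (pow_nonneg (growth_pos h).le _)
  calc _ ≤ ((n * (h ^ n * (2 * n * t) ^ n) : ℕ) : ℝ) := by exact_mod_cast hcard'
    _ = (h : ℝ) ^ n * ((n * (2 * n) ^ n) * (t : ℝ) ^ n) := by push_cast; ring
    _ ≤ (h : ℝ) ^ n * (growth h ^ D₁ * (growth h ^ D₀) ^ n) := by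
      have := growth_pos h
      gcongr
      exact hD₁ h hh
    _ = _ := by ring

/-- Resultants of difference polynomials have polynomial size. -/
lemma exists_resultant_diffPoly_le (n : ℕ) :
    ∃ c : ℕ, ∀ h : ℕ, 3 ≤ h → ∀ x ∈ box n (2 * h), ∀ y ∈ box n (2 * h),
      ∀ x' ∈ box n (2 * h), ∀ y' ∈ box n (2 * h),
      (resultant (diffPoly x y) (diffPoly x' y')).natAbs ≤ h ^ c := by
  set k := (2 * n).factorial with hk
  refine ⟨k + 2 * n * (2 * n), fun h hh x hx y hy x' hx' y' hy' ↦ ?_⟩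
  have h1 := abs_resultant_le (M := (1 + (2 * h : ℕ) : ℤ) ^ n)
    (by apply one_le_pow₀; push_cast; omega) (natDegree_diffPoly_le x y)
    (natDegree_diffPoly_le x' y') (abs_coeff_diffPoly_le hx hy) (abs_coeff_diffPoly_le hx' hy')
  rw [Int.abs_eq_natAbs] at h1
  have h2 : (resultant (diffPoly x y) (diffPoly x' y')).natAbs ≤
      k * ((1 + 2 * h) ^ n) ^ (2 * n) := by exact_mod_cast h1
  refine h2.trans ?_
  have e1 : k ≤ h ^ k := (Nat.lt_pow_self (by omega)).le
  calc k * ((1 + 2 * h) ^ n) ^ (2 * n) ≤ h ^ k * ((h ^ 2) ^ n) ^ (2 * n) := by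
        gcongr
        nlinarith
    _ = _ := by ring

/-- Pairs in the box with equal nonzero shifted products modulo `p`. -/
noncomputable def solutions (n p h : ℕ) (s : ZMod p) : Finset ((Fin n → ℤ) × (Fin n → ℤ)) := by
  classical exact (box n h ×ˢ box n h).filter fun xy ↦
    (∏ i, ((xy.1 i : ZMod p) + s)) = (∏ i, ((xy.2 i : ZMod p) + s)) ∧
      (∏ i, ((xy.1 i : ZMod p) + s)) ≠ 0

/-- Pairs in the box with equal shifted products and no coordinates in common modulo `p`. -/
noncomputable def disjointSolutions (n p h : ℕ) (s : ZMod p) :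
    Finset ((Fin n → ℤ) × (Fin n → ℤ)) := by
  classical exact (box n h ×ˢ box n h).filter fun xy ↦
    (∏ i, ((xy.1 i : ZMod p) + s)) = (∏ i, ((xy.2 i : ZMod p) + s)) ∧
      ∀ i j, (xy.1 i : ZMod p) ≠ xy.2 j

lemma card_residue_le {p : ℕ} (hp : 0 < p) (h : ℕ) (a : ZMod p) :
    ((Finset.Icc 1 (h : ℤ)).filter fun u : ℤ ↦ (u : ZMod p) = a).card ≤ h / p + 1 := by
  obtain ⟨v, rfl⟩ := ZMod.intCast_surjective a
  have h1 : (Finset.Icc 1 (h : ℤ)).filter (fun u : ℤ ↦ (u : ZMod p) = v) =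
      (Finset.Ioc 0 (h : ℤ)).filter fun u ↦ u ≡ v [ZMOD p] := by
    ext u
    simp only [Finset.mem_filter, Finset.mem_Icc, Finset.mem_Ioc, ZMod.intCast_eq_intCast_iff]
    constructor <;> rintro ⟨⟨h1, h2⟩, h3⟩ <;> exact ⟨⟨by omega, h2⟩, h3⟩
  have h2 := Int.Ioc_filter_modEq_card 0 (h : ℤ) (r := p) (by exact_mod_cast hp) v
  rw [← h1] at h2
  have hpq : (0 : ℚ) < p := by exact_mod_cast hp
  have e1 : (h : ℚ) / p < (h / p : ℕ) + 1 := by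
    rw [div_lt_iff₀ hpq]
    have := Nat.lt_div_mul_add (a := h) hp
    have h4 : h < (h / p + 1) * p := by linarith
    exact_mod_cast h4
  have e2 := Int.lt_floor_add_one ((((0 : ℤ) : ℚ) - (v : ℚ)) / p)
  generalize ⌊(((0 : ℤ) : ℚ) - (v : ℚ)) / p⌋ = F at e2 h2
  generalize h / p = q at e1 ⊢
  have h3 : ⌊(((h : ℤ) : ℚ) - v) / (p : ℚ)⌋ ≤ q + 1 + F := by
    rw [← Int.lt_add_one_iff, Int.floor_lt]
    rw [sub_div] at e2 ⊢
    push_cast at e2 ⊢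
    rw [zero_div] at e2
    linarith
  have h4 : (((Finset.Icc 1 (h : ℤ)).filter fun u : ℤ ↦ (u : ZMod p) = v).card : ℤ) ≤ q + 1 := by
    rw [h2]
    push_cast at h3 ⊢
    exact max_le (by linarith) (by positivity)
  exact_mod_cast h4

/-- Cancelling a common coordinate bounds solutions by disjoint and shorter solutions. -/
lemma card_solutions_succ_le {n p h g : ℕ} [Fact p.Prime] (s : ZMod p)
    (hg : ∀ a : ZMod p, ((Finset.Icc 1 (h : ℤ)).filter fun u : ℤ ↦ (u : ZMod p) = a).card ≤ g) :
    (solutions (n + 1) p h s).card ≤ (disjointSolutions (n + 1) p h s).card +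
      (n + 1) * ((n + 1) * (h * (g * (solutions n p h s).card))) := by
  classical
  set V : Fin (n + 1) → Fin (n + 1) → Finset ((Fin (n + 1) → ℤ) × (Fin (n + 1) → ℤ)) :=
    fun i j ↦ (solutions (n + 1) p h s).filter fun xy ↦ (xy.1 i : ZMod p) = xy.2 j with hV
  have hsub : solutions (n + 1) p h s ⊆ disjointSolutions (n + 1) p h s ∪
      Finset.univ.biUnion fun i ↦ Finset.univ.biUnion fun j ↦ V i j := by
    intro xy hxy
    rw [Finset.mem_union]
    by_cases hd : ∀ i j, (xy.1 i : ZMod p) ≠ xy.2 j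
    · left
      simp only [solutions, disjointSolutions, Finset.mem_filter] at hxy ⊢
      exact ⟨hxy.1, hxy.2.1, hd⟩
    · right
      push Not at hd
      obtain ⟨i, j, hij⟩ := hd
      simp only [Finset.mem_biUnion, Finset.mem_univ, true_and, hV, Finset.mem_filter]
      exact ⟨i, j, hxy, hij⟩
  refine (Finset.card_le_card hsub).trans ((Finset.card_union_le _ _).trans ?_)
  gcongr
  have hVcard : ∀ i j, (V i j).card ≤ h * (g * (solutions n p h s).card) := by
    intro i j
    set U : Finset (ℤ × ℤ) := (Finset.Icc 1 (h : ℤ)).biUnion fun u ↦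
      ((Finset.Icc 1 (h : ℤ)).filter fun v : ℤ ↦ (v : ZMod p) = (u : ZMod p)).image
        fun v ↦ (u, v) with hU
    have hUcard : U.card ≤ h * g := by
      have := Finset.card_biUnion_le_card_mul (Finset.Icc 1 (h : ℤ)) (fun u ↦
        ((Finset.Icc 1 (h : ℤ)).filter fun v : ℤ ↦ (v : ZMod p) = (u : ZMod p)).image
        fun v ↦ (u, v)) g fun u _ ↦ Finset.card_image_le.trans (hg _)
      simpa using this
    have hinj : (V i j).card ≤ (U ×ˢ solutions n p h s).card := by
      refine Finset.card_le_card_of_injOn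
        (fun xy ↦ ((xy.1 i, xy.2 j), (i.removeNth xy.1, j.removeNth xy.2))) ?_ ?_
      · rintro ⟨x, y⟩ hxy
        simp only [hV, Finset.coe_filter, Set.mem_ofPred_eq, solutions, Finset.mem_filter,
          Finset.mem_product, mem_box] at hxy
        obtain ⟨⟨⟨hx, hy⟩, heq, hne⟩, hij⟩ := hxy
        rw [Fin.prod_univ_succAbove _ i] at heq hne
        rw [Fin.prod_univ_succAbove _ j, hij] at heq
        rw [hij] at hne
        simp only [Finset.coe_product, Set.mem_prod, Finset.mem_coe, hU, Finset.mem_biUnion,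
          Finset.mem_image, Finset.mem_filter, solutions, Finset.mem_product, mem_box,
          Fin.removeNth_apply]
        refine ⟨⟨x i, Finset.mem_Icc.mpr (hx i), y j, ⟨Finset.mem_Icc.mpr (hy j), hij.symm⟩, rfl⟩,
          ⟨fun k ↦ hx _, fun k ↦ hy _⟩, ?_, right_ne_zero_of_mul hne⟩
        exact mul_left_cancel₀ (left_ne_zero_of_mul hne) heq
      · rintro ⟨x, y⟩ - ⟨x', y'⟩ - hxy
        simp only [Prod.mk.injEq] at hxy
        obtain ⟨⟨h1, h2⟩, h3, h4⟩ := hxy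
        rw [Prod.mk.injEq, ← Fin.insertNth_self_removeNth i x, ← Fin.insertNth_self_removeNth i x',
          ← Fin.insertNth_self_removeNth j y, ← Fin.insertNth_self_removeNth j y', h1, h2, h3, h4]
        exact ⟨rfl, rfl⟩
    rw [Finset.card_product] at hinj
    calc _ ≤ _ := hinj
      _ ≤ h * g * (solutions n p h s).card := by gcongr
      _ = _ := by ring
  have := Finset.card_biUnion_le_card_mul (Finset.univ : Finset (Fin (n + 1)))
    (fun i ↦ Finset.univ.biUnion fun j ↦ V i j) _ fun i _ ↦
      Finset.card_biUnion_le_card_mul (Finset.univ : Finset (Fin (n + 1))) (V i) _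
        fun j _ ↦ hVcard i j
  simpa using this

lemma map_shiftPoly_eval {n p : ℕ} (x : Fin n → ℤ) (s : ZMod p) :
    ((shiftPoly x).map (Int.castRingHom (ZMod p))).eval s = ∏ i, ((x i : ZMod p) + s) := by
  rw [shiftPoly, Polynomial.map_prod, eval_prod]
  refine Finset.prod_congr rfl fun i _ ↦ ?_
  rw [Polynomial.map_add, map_X, map_C, eval_add, eval_X, eval_C, eq_intCast, add_comm]

lemma map_diffPoly_eval {n p : ℕ} (x y : Fin n → ℤ) (s : ZMod p) :
    ((diffPoly x y).map (Int.castRingHom (ZMod p))).eval s =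
      ∏ i, ((x i : ZMod p) + s) - ∏ i, ((y i : ZMod p) + s) := by
  rw [diffPoly, Polynomial.map_sub, eval_sub, map_shiftPoly_eval, map_shiftPoly_eval]

lemma map_diffPoly_ne_zero {n p : ℕ} [Fact p.Prime] (hn : 0 < n) {x y : Fin n → ℤ}
    (hxy : ∀ i j, (x i : ZMod p) ≠ y j) :
    (diffPoly x y).map (Int.castRingHom (ZMod p)) ≠ 0 := by
  intro h0
  have h1 := map_diffPoly_eval x y (-(x ⟨0, hn⟩ : ZMod p))
  rw [h0, eval_zero, Finset.prod_eq_zero (Finset.mem_univ ⟨0, hn⟩) (by ring), zero_sub, eq_comm,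
    neg_eq_zero, Finset.prod_eq_zero_iff] at h1
  obtain ⟨j, -, hj⟩ := h1
  exact hxy _ j (by linear_combination -hj)

lemma natDegree_ne_zero_of_root {p : ℕ} {f : ℤ[X]}
    (hf : f.map (Int.castRingHom (ZMod p)) ≠ 0) {s : ZMod p}
    (hs : (f.map (Int.castRingHom (ZMod p))).eval s = 0) : f.natDegree ≠ 0 := by
  intro h0
  obtain ⟨c, rfl⟩ := natDegree_eq_zero.mp h0
  rw [map_C, eval_C] at hs
  apply hf
  rw [map_C, hs, C_0]

/-- Pairs of pairs whose difference polynomials are coprime but have resultant divisible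
by `p`. -/
noncomputable def degenerate (n p h : ℕ) :
    Finset (((Fin n → ℤ) × (Fin n → ℤ)) × ((Fin n → ℤ) × (Fin n → ℤ))) := by
  classical exact ((box n h ×ˢ box n h) ×ˢ (box n h ×ˢ box n h)).filter fun q ↦
    (∀ i j, (q.1.1 i : ZMod p) ≠ q.1.2 j) ∧
    ¬ ShareFactor (diffPoly q.1.1 q.1.2) (diffPoly q.2.1 q.2.2) ∧
    (p : ℤ) ∣ resultant (diffPoly q.1.1 q.1.2) (diffPoly q.2.1 q.2.2)

/-- Translation of a pair of tuples. -/
def translatePair {n : ℕ} (t : ℤ) (xy : (Fin n → ℤ) × (Fin n → ℤ)) : (Fin n → ℤ) × (Fin n → ℤ) :=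
  (fun i ↦ xy.1 i + t, fun i ↦ xy.2 i + t)

lemma translatePair_injective {n : ℕ} (t : ℤ) : Function.Injective (translatePair (n := n) t) := by
  rintro ⟨x, y⟩ ⟨x', y'⟩ h
  simp only [translatePair, Prod.mk.injEq, funext_iff, add_left_inj] at h
  exact Prod.ext (funext h.1) (funext h.2)

open Classical in
/-- Translating pairs of disjoint solutions produces many degenerate quadruples. -/
lemma mul_card_not_shareFactor_le {n p h g : ℕ} [Fact p.Prime] (hn : 0 < n) (s : ZMod p)
    (hg : ∀ a : ZMod p, ((Finset.Icc 1 (h : ℤ)).filter fun u : ℤ ↦ (u : ZMod p) = a).card ≤ g) :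
    h * ((disjointSolutions n p h s ×ˢ disjointSolutions n p h s).filter fun q ↦
      ¬ ShareFactor (diffPoly q.1.1 q.1.2) (diffPoly q.2.1 q.2.2)).card ≤
      n * g * (degenerate n p (2 * h)).card := by
  set S := (disjointSolutions n p h s ×ˢ disjointSolutions n p h s).filter fun q ↦
      ¬ ShareFactor (diffPoly q.1.1 q.1.2) (diffPoly q.2.1 q.2.2) with hS
  have hroot : ∀ ab ∈ disjointSolutions n p h s, ∀ t : ℤ,
      ((diffPoly (translatePair t ab).1 (translatePair t ab).2).map (Int.castRingHom (ZMod p))).eval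
        (s - t) = 0 := by
    intro ab hab t
    simp only [disjointSolutions, Finset.mem_filter] at hab
    rw [map_diffPoly_eval, sub_eq_zero]
    simpa [translatePair] using hab.2.1
  have hdisj : ∀ ab ∈ disjointSolutions n p h s, ∀ t : ℤ, ∀ i j,
      ((translatePair t ab).1 i : ZMod p) ≠ (translatePair t ab).2 j := by
    intro ab hab t i j
    simp only [disjointSolutions, Finset.mem_filter] at hab
    simpa [translatePair] using hab.2.2 i j
  have hbox : ∀ ab ∈ disjointSolutions n p h s, ∀ t ∈ Finset.Icc 1 (h : ℤ),
      translatePair t ab ∈ box n (2 * h) ×ˢ box n (2 * h) := by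
    intro ab hab t ht
    simp only [disjointSolutions, Finset.mem_filter, Finset.mem_product, mem_box] at hab
    rw [Finset.mem_Icc] at ht
    rw [Finset.mem_product, mem_box, mem_box]
    push_cast
    exact ⟨fun i ↦ by have := hab.1.1 i; simp only [translatePair]; omega,
      fun i ↦ by have := hab.1.2 i; simp only [translatePair]; omega⟩
  have hcard : (Finset.Icc 1 (h : ℤ) ×ˢ S).card = h * S.card := by simp
  rw [← hcard]
  refine Finset.card_le_mul_card_image_of_maps_to
    (f := fun tq ↦ (translatePair tq.1 tq.2.1, translatePair tq.1 tq.2.2)) ?_ _ ?_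
  · rintro ⟨t, a, b⟩ htq
    simp only [Finset.mem_product, hS, Finset.mem_filter] at htq
    obtain ⟨ht, ⟨ha, hb⟩, hns⟩ := htq
    simp only [degenerate, Finset.mem_filter]
    refine ⟨Finset.mem_product.mpr ⟨hbox a ha t ht, hbox b hb t ht⟩, hdisj a ha t, fun hsh ↦ ?_, ?_⟩
    · apply hns
      apply ShareFactor.of_taylor (t := t)
      rw [taylor_diffPoly, taylor_diffPoly]
      exact hsh
    · exact dvd_resultant_of_common_root
        (natDegree_ne_zero_of_root (map_diffPoly_ne_zero hn (hdisj a ha t)) (hroot a ha t))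
        (hroot a ha t) (hroot b hb t)
  · rintro ⟨u, v⟩ huv
    simp only [degenerate, Finset.mem_filter] at huv
    set F := (diffPoly u.1 u.2).map (Int.castRingHom (ZMod p)) with hF
    have hF0 : F ≠ 0 := map_diffPoly_ne_zero hn huv.2.1
    have hle : (F.roots.toFinset.biUnion fun r ↦
        (Finset.Icc 1 (h : ℤ)).filter fun t : ℤ ↦ (t : ZMod p) = s - r).card ≤ n * g := by
      refine (Finset.card_biUnion_le_card_mul _ _ g fun r _ ↦ hg _).trans ?_
      gcongr
      refine (Multiset.toFinset_card_le _).trans ((card_roots' _).trans ?_)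
      exact natDegree_map_le.trans (natDegree_diffPoly_le _ _)
    refine le_trans ?_ hle
    refine Finset.card_le_card_of_injOn Prod.fst ?_ ?_
    · rintro ⟨t, a, b⟩ htq
      simp only [Finset.coe_filter, Set.mem_ofPred_eq, Finset.mem_product, hS, Finset.mem_filter,
        Prod.mk.injEq] at htq
      obtain ⟨⟨ht, ⟨ha, hb⟩, hns⟩, rfl, rfl⟩ := htq
      simp only [Finset.coe_biUnion, Set.mem_iUnion, Finset.mem_coe, Finset.mem_filter,
        Multiset.mem_toFinset, mem_roots hF0, exists_prop]
      exact ⟨s - t, hroot a ha t, ht, by ring⟩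
    · rintro ⟨t, a, b⟩ h1 ⟨t', a', b'⟩ h2 (rfl : t = t')
      simp only [Finset.coe_filter, Set.mem_ofPred_eq, Prod.mk.injEq] at h1 h2
      have ha := translatePair_injective t (h1.2.1.trans h2.2.1.symm)
      have hb := translatePair_injective t (h1.2.2.trans h2.2.2.symm)
      rw [ha, hb]

/-- A quadratic inequality for the number of disjoint solutions. -/
lemma exists_sq_card_disjointSolutions_le {n : ℕ} (hn : 0 < n) :
    ∃ D : ℕ, ∀ h : ℕ, 3 ≤ h → ∀ p : ℕ, p.Prime → ∀ s : ZMod p, ∀ g : ℕ,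
      (∀ a : ZMod p, ((Finset.Icc 1 (h : ℤ)).filter fun u : ℤ ↦ (u : ZMod p) = a).card ≤ g) →
      (h : ℝ) * ((disjointSolutions n p h s).card : ℝ) ^ 2 ≤
        h * ((disjointSolutions n p h s).card * ((h : ℝ) ^ n * growth h ^ D)) +
          n * g * (degenerate n p (2 * h)).card := by
  classical
  obtain ⟨D, hD⟩ := exists_card_shareFactor_le n
  refine ⟨D, fun h hh p hp s g hg ↦ ?_⟩
  have := Fact.mk hp
  set S := disjointSolutions n p h s with hS
  have h1 := mul_card_not_shareFactor_le hn s hg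
  have h2 := Finset.card_filter_add_card_filter_not (s := S ×ˢ S) fun q ↦
    ShareFactor (diffPoly q.1.1 q.1.2) (diffPoly q.2.1 q.2.2)
  rw [Finset.card_product] at h2
  have h3 : (((S ×ˢ S).filter fun q ↦
      ShareFactor (diffPoly q.1.1 q.1.2) (diffPoly q.2.1 q.2.2)).card : ℝ) ≤
      S.card * ((h : ℝ) ^ n * growth h ^ D) := by
    rw [Finset.card_filter, Finset.sum_product, Nat.cast_sum, ← nsmul_eq_mul]
    refine Finset.sum_le_card_nsmul _ _ _ fun a ha ↦ ?_
    rw [← Finset.card_filter]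
    have ha' := ha
    simp only [hS, disjointSolutions, Finset.mem_filter, Finset.mem_product] at ha'
    refine le_trans ?_ (hD h hh (diffPoly a.1 a.2) ?_ (natDegree_diffPoly_le _ _)
      (abs_coeff_diffPoly_le ha'.1.1 ha'.1.2))
    · rw [Nat.cast_le]
      apply Finset.card_le_card
      intro b hb
      simp only [hS, disjointSolutions, Finset.mem_filter, Finset.mem_product] at hb ⊢
      exact ⟨hb.1.1, fun i j hij ↦ hb.1.2.2 i j (by rw [hij]), hb.2⟩
    · intro h0
      apply map_diffPoly_ne_zero hn ha'.2.2
      rw [h0, Polynomial.map_zero]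
  have h1' : (h : ℝ) * ((S ×ˢ S).filter fun q ↦
      ¬ ShareFactor (diffPoly q.1.1 q.1.2) (diffPoly q.2.1 q.2.2)).card ≤
      n * g * (degenerate n p (2 * h)).card := by exact_mod_cast h1
  have h2' : (((S ×ˢ S).filter fun q ↦
      ShareFactor (diffPoly q.1.1 q.1.2) (diffPoly q.2.1 q.2.2)).card : ℝ) +
      ((S ×ˢ S).filter fun q ↦
      ¬ ShareFactor (diffPoly q.1.1 q.1.2) (diffPoly q.2.1 q.2.2)).card = (S.card : ℝ) ^ 2 := by
    rw [pow_two]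
    exact_mod_cast h2
  rw [← h2', mul_add]
  gcongr

/-- Degenerate quadruples are rare on average over primes. -/
lemma exists_sum_card_degenerate_le {n : ℕ} (hn : 0 < n) :
    ∃ c : ℕ, ∀ h : ℕ, 3 ≤ h → ∀ P : Finset ℕ, (∀ p ∈ P, p.Prime) →
      ∑ p ∈ P, ((degenerate n p (2 * h)).card : ℝ) ≤ c * ((h : ℝ) ^ (4 * n) * Real.log h) := by
  classical
  obtain ⟨c, hc⟩ := exists_resultant_diffPoly_le n
  refine ⟨2 ^ (4 * n) * (2 * c), fun h hh P hP ↦ ?_⟩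
  set Q := (box n (2 * h) ×ˢ box n (2 * h)) ×ˢ (box n (2 * h) ×ˢ box n (2 * h)) with hQ
  have hL := one_lt_log_of_three_le hh
  have hsum : ∑ p ∈ P, (degenerate n p (2 * h)).card =
      ∑ q ∈ Q, (P.filter fun p ↦ q ∈ degenerate n p (2 * h)).card := by
    have hfil : ∀ p, degenerate n p (2 * h) = Q.filter (· ∈ degenerate n p (2 * h)) := by
      intro p
      ext q
      simp only [degenerate, Finset.mem_filter, hQ]
      tauto
    have := Finset.sum_card_bipartiteAbove_eq_sum_card_bipartiteBelow
      (s := P) (t := Q) fun p q ↦ q ∈ degenerate n p (2 * h)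
    simp only [Finset.bipartiteAbove, Finset.bipartiteBelow] at this
    rw [← this]
    exact Finset.sum_congr rfl fun p _ ↦ by rw [← hfil]
  have hq : ∀ q ∈ Q, ((P.filter fun p ↦ q ∈ degenerate n p (2 * h)).card : ℝ) ≤
      2 * c * Real.log h := by
    intro q hq
    simp only [hQ, Finset.mem_product] at hq
    rcases (P.filter fun p ↦ q ∈ degenerate n p (2 * h)).eq_empty_or_nonempty with he | ⟨p₀, hp₀⟩
    · rw [he, Finset.card_empty]
      push_cast
      positivity
    set R := resultant (diffPoly q.1.1 q.1.2) (diffPoly q.2.1 q.2.2) with hR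
    have hR0 : R ≠ 0 := by
      simp only [Finset.mem_filter, degenerate] at hp₀
      have := Fact.mk (hP _ hp₀.1)
      refine resultant_ne_zero_of_not_shareFactor (fun h0 ↦ ?_) hp₀.2.2.2.1
      apply map_diffPoly_ne_zero hn hp₀.2.2.1
      rw [h0, Polynomial.map_zero]
    have hRle : R.natAbs ≤ h ^ c :=
      hc h hh _ hq.1.1 _ hq.1.2 _ hq.2.1 _ hq.2.2
    have hsub : (P.filter fun p ↦ q ∈ degenerate n p (2 * h)) ⊆ R.natAbs.primeFactors := by
      intro p hp
      simp only [Finset.mem_filter, degenerate] at hp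
      rw [Nat.mem_primeFactors]
      exact ⟨hP p hp.1, Int.natCast_dvd.mp hp.2.2.2.2, by simpa using hR0⟩
    have hcard := Finset.card_le_card hsub
    have hpow : 2 ^ R.natAbs.primeFactors.card ≤ R.natAbs :=
      (Finset.pow_card_le_prod _ _ _ fun p hp ↦ (Nat.prime_of_mem_primeFactors hp).two_le).trans
        (Nat.le_of_dvd (by omega) (Nat.prod_primeFactors_dvd _))
    have h2 : (2 : ℝ) ^ (P.filter fun p ↦ q ∈ degenerate n p (2 * h)).card ≤ (h : ℝ) ^ c := by
      exact_mod_cast (Nat.pow_le_pow_right (by norm_num) hcard).trans (hpow.trans hRle)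
    have h3 := Real.log_le_log (by positivity) h2
    rw [Real.log_pow, Real.log_pow] at h3
    have := Real.log_two_gt_d9
    have h4 : (0 : ℝ) ≤ (P.filter fun p ↦ q ∈ degenerate n p (2 * h)).card := by positivity
    nlinarith
  calc ∑ p ∈ P, ((degenerate n p (2 * h)).card : ℝ)
      = ∑ q ∈ Q, ((P.filter fun p ↦ q ∈ degenerate n p (2 * h)).card : ℝ) := by
        exact_mod_cast hsum
    _ ≤ Q.card • (2 * c * Real.log h) := Finset.sum_le_card_nsmul _ _ _ hq
    _ = _ := by
      rw [hQ, Finset.card_product, Finset.card_product, card_box, nsmul_eq_mul]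
      push_cast
      ring

end

lemma le_add_of_sq_le {k a b : ℝ} (ha : 0 ≤ a) (hb : 0 ≤ b) (h : k ^ 2 ≤ k * a + b ^ 2) :
    k ≤ a + b := by
  by_contra! hk
  nlinarith [mul_pos (sub_pos.mpr hk) (sub_pos.mpr hk), mul_nonneg ha hb]

/-- Away from primes with many degenerate quadruples, the number of solutions is bounded. -/
lemma exists_card_solutions_le (E : ℕ → ℕ) (n : ℕ) :
    ∃ D : ℕ, ∀ h : ℕ, 3 ≤ h → ∀ T : ℝ, 0 < T → ∀ p : ℕ, p.Prime →
      ((h / p + 1 : ℕ) : ℝ) ≤ growth h →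
      (∀ m, 1 ≤ m → m ≤ n →
        ((degenerate m p (2 * h)).card : ℝ) ≤ (h : ℝ) ^ (4 * m) * growth h ^ E m / T) →
      ∀ s : ZMod p, ((solutions n p h s).card : ℝ) ≤
        growth h ^ D * ((h : ℝ) ^ n + (h : ℝ) ^ (2 * n) * (√(h * T))⁻¹) := by
  induction n with
  | zero =>
    refine ⟨0, fun h hh T hT p hp hg hE s ↦ ?_⟩
    have h1 : (solutions 0 p h s).card ≤ 1 := by
      refine (Finset.card_le_card (Finset.filter_subset _ _)).trans ?_
      rw [Finset.card_product, card_box]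
      simp
    have h2 : ((solutions 0 p h s).card : ℝ) ≤ 1 := by exact_mod_cast h1
    have h3 : 0 ≤ (√(h * T))⁻¹ := by positivity
    simp only [pow_zero, mul_zero, one_mul]
    linarith
  | succ n ih =>
    obtain ⟨c, hc⟩ := ih
    obtain ⟨D, hD⟩ := exists_sq_card_disjointSolutions_le n.succ_pos
    obtain ⟨k, hk⟩ := exists_const_le_growth_pow ((n + 1 : ℕ) : ℝ)
    refine ⟨D + (k + 1 + E (n + 1)) + (k + k + 1 + c) + 2, fun h hh T hT p hp hg hE s ↦ ?_⟩
    have := Fact.mk hp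
    have hW := one_le_growth hh
    have hW2 := two_le_growth hh
    have hkh := hk h hh
    have hh0 : (0 : ℝ) < h := by positivity
    have h1 := hD h hh p hp s _ (card_residue_le hp.pos h)
    have h2 : ((solutions (n + 1) p h s).card : ℝ) ≤ _ :=
      Nat.cast_le.mpr (card_solutions_succ_le s (card_residue_le hp.pos h))
    have h3 := hc h hh T hT p hp hg (fun m h1 h2 ↦ hE m h1 (by omega)) s
    have h4 := hE (n + 1) (by omega) le_rfl
    set W := growth h
    set q := (√(h * T))⁻¹ with hq
    have hq0 : 0 ≤ q := by positivity
    have hq2 : q ^ 2 = (h * T)⁻¹ := by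
      rw [hq, inv_pow, Real.sq_sqrt (by positivity)]
    set K : ℝ := ((disjointSolutions (n + 1) p h s).card : ℝ)
    set G : ℝ := ((h / p + 1 : ℕ) : ℝ)
    set N : ℝ := ((n + 1 : ℕ) : ℝ)
    have hG0 : 0 ≤ G := by positivity
    have hN0 : 0 ≤ N := by positivity
    set e := k + 1 + E (n + 1) with he
    have h5 : K ≤ (h : ℝ) ^ (n + 1) * W ^ D + W ^ e * ((h : ℝ) ^ (2 * (n + 1)) * q) := by
      apply le_add_of_sq_le (by positivity) (by positivity)
      refine le_of_mul_le_mul_left (h1.trans ?_) hh0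
      rw [mul_add]
      refine add_le_add le_rfl ?_
      calc N * G * ((degenerate (n + 1) p (2 * h)).card : ℝ)
          ≤ W ^ k * W * ((h : ℝ) ^ (4 * (n + 1)) * W ^ E (n + 1) / T) := by gcongr
        _ = W ^ e * ((h : ℝ) ^ (4 * (n + 1)) / T) := by rw [he]; ring
        _ ≤ W ^ (e + e) * ((h : ℝ) ^ (4 * (n + 1)) / T) := by
          gcongr
          · omega
        _ = h * (W ^ e * ((h : ℝ) ^ (2 * (n + 1)) * q)) ^ 2 := by
          rw [mul_pow, mul_pow, hq2]
          field_simp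
          ring
    set X := (h : ℝ) ^ (n + 1) + (h : ℝ) ^ (2 * (n + 1)) * q with hX
    have hX0 : 0 ≤ X := by positivity
    have h6 : (h : ℝ) * ((h : ℝ) ^ n + (h : ℝ) ^ (2 * n) * q) ≤ X := by
      have : (h : ℝ) ^ (2 * n + 1) ≤ (h : ℝ) ^ (2 * (n + 1)) := by
        gcongr
        · exact_mod_cast (by omega : 1 ≤ h)
        · omega
      calc _ = (h : ℝ) ^ (n + 1) + (h : ℝ) ^ (2 * n + 1) * q := by ring
        _ ≤ _ := by rw [hX]; gcongr
    have h7 : N * (N * (h * (G * ((solutions n p h s).card : ℝ)))) ≤ W ^ (k + k + 1 + c) * X := by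
      calc _ ≤ W ^ k * (W ^ k * (h * (W * (W ^ c * ((h : ℝ) ^ n + (h : ℝ) ^ (2 * n) * q))))) := by
            gcongr
        _ = W ^ (k + k + 1 + c) * (h * ((h : ℝ) ^ n + (h : ℝ) ^ (2 * n) * q)) := by ring
        _ ≤ _ := by gcongr
    set M := D + e + (k + k + 1 + c) with hM
    have i1 : (h : ℝ) ^ (n + 1) * W ^ D ≤ W ^ M * X := by
      rw [mul_comm]
      gcongr
      · omega
      · rw [hX]; exact le_add_of_nonneg_right (by positivity)
    have i2 : W ^ e * ((h : ℝ) ^ (2 * (n + 1)) * q) ≤ W ^ M * X := by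
      gcongr
      · omega
      · rw [hX]; exact le_add_of_nonneg_left (by positivity)
    have i3 : W ^ (k + k + 1 + c) * X ≤ W ^ M * X := by
      gcongr
      · omega
    push_cast at h2
    have h8 : ((solutions (n + 1) p h s).card : ℝ) ≤
        K + N * (N * (h * (G * ((solutions n p h s).card : ℝ)))) := by
      simpa [N, G, K] using h2
    have h9 : 3 ≤ W ^ 2 := by nlinarith
    have h10 : 0 ≤ W ^ M * X := by positivity
    calc _ ≤ 3 * (W ^ M * X) := by linarith
      _ ≤ W ^ 2 * (W ^ M * X) := by gcongr
      _ = _ := by ring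

open Classical in
/-- The number of primes with many degenerate quadruples. -/
lemma exists_card_filter_degenerate_le {n : ℕ} (hn : 0 < n) :
    ∃ E c : ℕ, ∀ h : ℕ, 3 ≤ h → ∀ P : Finset ℕ, (∀ p ∈ P, p.Prime) → ∀ T : ℝ, 0 < T →
      let B := P.filter fun p ↦
        (h : ℝ) ^ (4 * n) * growth h ^ E / T < ((degenerate n p (2 * h)).card : ℝ)
      (B.card : ℝ) ≤ T / growth h ∧ (B.card : ℝ) ≤ c * (h : ℝ) ^ (4 * n + 1) := by
  obtain ⟨c, hc⟩ := exists_sum_card_degenerate_le hn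
  obtain ⟨k, hk⟩ := exists_const_le_growth_pow (c : ℝ)
  refine ⟨k + 17, c, fun h hh P hP T hT ↦ ?_⟩
  intro B
  have hW := growth_pos h
  have hh0 : (0 : ℝ) < h := by positivity
  have hL := one_lt_log_of_three_le hh
  have hsum := hc h hh B fun p hp ↦ hP p (Finset.mem_of_mem_filter p hp)
  have hlt : ∀ p ∈ B, (h : ℝ) ^ (4 * n) * growth h ^ (k + 17) / T <
      ((degenerate n p (2 * h)).card : ℝ) := fun p hp ↦ (Finset.mem_filter.mp hp).2
  constructor
  · have h1 := (Finset.card_nsmul_le_sum B _ _ fun p hp ↦ (hlt p hp).le).trans hsum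
    have h2 : c * ((h : ℝ) ^ (4 * n) * Real.log h) ≤
        growth h ^ k * ((h : ℝ) ^ (4 * n) * growth h ^ 16) := by
      gcongr
      · exact hk h hh
      · exact log_le_growth_pow hh
    rw [nsmul_eq_mul] at h1
    have h3 := h1.trans h2
    rw [le_div_iff₀ hW]
    have hpos : 0 < (h : ℝ) ^ (4 * n) * growth h ^ (k + 16) := by positivity
    refine le_of_mul_le_mul_left ?_ hpos
    calc _ = (B.card * ((h : ℝ) ^ (4 * n) * growth h ^ (k + 17) / T)) * T := by
          field_simp
          ring
      _ ≤ (growth h ^ k * ((h : ℝ) ^ (4 * n) * growth h ^ 16)) * T := by gcongr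
      _ = _ := by ring
  · have h1 : (B.card : ℝ) ≤ ∑ p ∈ B, ((degenerate n p (2 * h)).card : ℝ) := by
      rw [← mul_one (B.card : ℝ), ← nsmul_eq_mul]
      refine Finset.card_nsmul_le_sum B _ _ fun p hp ↦ ?_
      have : (0 : ℝ) < ((degenerate n p (2 * h)).card : ℝ) :=
        lt_of_le_of_lt (by positivity) (hlt p hp)
      exact_mod_cast this
    refine (h1.trans hsum).trans ?_
    rw [pow_succ]
    gcongr
    exact (Real.log_le_sub_one_of_pos hh0).trans (by linarith)

/-- The growth factor beats powers of `log T` when `h` is at least a power of `T`. -/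
lemma exists_mul_sq_log_le_growth (A : ℕ) (M : ℝ) :
    ∃ T₀ : ℝ, ∀ T : ℝ, T₀ ≤ T → ∀ h : ℕ, 3 ≤ h → T ≤ (h : ℝ) ^ A →
      M * Real.log T ^ 2 ≤ growth h := by
  obtain ⟨y₀, hy₀⟩ := Filter.eventually_atTop.mp
    ((Real.tendsto_exp_div_pow_atTop 4).eventually_ge_atTop (|M| * A ^ 2 * 256))
  set y₁ := max y₀ 1
  refine ⟨max 1 (Real.exp (A * (4 * y₁) ^ 2)), fun T hT h hh hA ↦ ?_⟩
  have hL := one_lt_log_of_three_le hh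
  set L := Real.log h with hLdef
  have hT1 : 1 ≤ T := (le_max_left _ _).trans hT
  have hT2 : A * (4 * y₁) ^ 2 ≤ Real.log T := by
    rw [Real.le_log_iff_exp_le (by linarith)]
    exact (le_max_right _ _).trans hT
  have hT3 : Real.log T ≤ A * L := by
    rw [hLdef, ← Real.log_pow]
    exact Real.log_le_log (by linarith) hA
  have hlogT : 0 ≤ Real.log T := Real.log_nonneg hT1
  rcases Nat.eq_zero_or_pos A with rfl | hApos
  · have : Real.log T = 0 := by
      simp only [Nat.cast_zero, zero_mul] at hT3
      linarith
    rw [this]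
    simpa using (growth_pos h).le
  have hA0 : (0 : ℝ) < A := by exact_mod_cast hApos
  have hy1 : 1 ≤ y₁ := le_max_right _ _
  have hLy : (4 * y₁) ^ 2 ≤ L := le_of_mul_le_mul_left (hT2.trans hT3) hA0
  set y := √L / 4 with hy
  have hsL : √L = 4 * y := by rw [hy]; ring
  have hL2 : L = 16 * y ^ 2 := by
    rw [← Real.sq_sqrt (show 0 ≤ L by linarith), hsL]; ring
  have hyy : y₁ ≤ y := by
    have := Real.le_sqrt_of_sq_le hLy
    linarith
  have h1 := hy₀ y ((le_max_left _ _).trans hyy)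
  have hypos : 0 < y := by linarith
  rw [le_div_iff₀ (by positivity)] at h1
  calc M * Real.log T ^ 2 ≤ |M| * (A * L) ^ 2 := by
        gcongr
        exact le_abs_self M
    _ = |M| * A ^ 2 * 256 * y ^ 4 := by rw [hL2]; ring
    _ ≤ Real.exp y := h1
    _ ≤ growth h := by
      rw [growth, Real.exp_le_exp, le_div_iff₀ (loglog_pos hh), ← hLdef]
      have := log_le_four_mul_sqrt hL.le
      rw [hsL] at this
      nlinarith

open Classical in
/-- Few primes have many degenerate quadruples. -/
lemma exists_card_filter_degenerate_le_div_sq_log {n : ℕ} (hn : 0 < n) :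
    ∃ E : ℕ, ∀ δ : ℝ, 0 < δ → ∃ T₀ : ℝ, ∀ T : ℝ, T₀ ≤ T → ∀ h : ℕ, 3 ≤ h →
      ∀ P : Finset ℕ, (∀ p ∈ P, p.Prime) →
      ((P.filter fun p ↦ (h : ℝ) ^ (4 * n) * growth h ^ E / T <
        ((degenerate n p (2 * h)).card : ℝ)).card : ℝ) ≤ δ * T / Real.log T ^ 2 := by
  obtain ⟨E, c, hE⟩ := exists_card_filter_degenerate_le hn
  refine ⟨E, fun δ hδ ↦ ?_⟩
  obtain ⟨T₁, hT₁⟩ := exists_mul_sq_log_le_growth ((4 * n + 1) * 4) δ⁻¹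
  refine ⟨max T₁ (max 2 ((16 * c / δ) ^ 4)), fun T hT h hh P hP ↦ ?_⟩
  simp only [max_le_iff] at hT
  obtain ⟨hT1, hT2, hT3⟩ := hT
  have hT0 : 0 < T := by linarith
  have hlog : 0 < Real.log T := Real.log_pos (by linarith)
  obtain ⟨h1, h2⟩ := hE h hh P hP T hT0
  rcases le_total T ((h : ℝ) ^ ((4 * n + 1) * 4)) with hA | hA
  · refine h1.trans ?_
    have := hT₁ T hT1 h hh hA
    rw [div_le_div_iff₀ (growth_pos h) (by positivity)]
    calc T * Real.log T ^ 2 = δ * T * (δ⁻¹ * Real.log T ^ 2) := by field_simp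
      _ ≤ _ := by gcongr
  · refine h2.trans ?_
    rw [le_div_iff₀ (by positivity)]
    have e1 : (h : ℝ) ^ (4 * n + 1) ≤ √(√T) := by
      apply Real.le_sqrt_of_sq_le
      apply Real.le_sqrt_of_sq_le
      rw [← pow_mul, ← pow_mul]
      simpa [mul_assoc] using hA
    have e2 : 16 * c / δ ≤ √(√T) := by
      apply Real.le_sqrt_of_sq_le
      apply Real.le_sqrt_of_sq_le
      rw [← pow_mul]
      simpa using hT3
    rw [div_le_iff₀ hδ] at e2
    have e3 := sq_log_le_sqrt (L := T) (by linarith)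
    have e4 : √(√T) * √(√T) = √T := Real.mul_self_sqrt (by positivity)
    have e5 : √T * √T = T := Real.mul_self_sqrt (by positivity)
    calc c * (h : ℝ) ^ (4 * n + 1) * Real.log T ^ 2 ≤ c * √(√T) * (16 * √T) := by gcongr
      _ = 16 * c * √(√T) * √T := by ring
      _ ≤ √(√T) * δ * √(√T) * √T := by gcongr
      _ = δ * (√(√T) * √(√T) * √T) := by ring
      _ = δ * T := by rw [e4, e5]

/-- For primes that are not too small, residue classes in `[1, h]` are small. -/
lemma exists_div_add_one_le_growth {δ : ℝ} (hδ : 0 < δ) :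
    ∃ T₀ : ℝ, ∀ T : ℝ, T₀ ≤ T → ∀ h : ℕ, 3 ≤ h → (h : ℝ) < T → ∀ p : ℕ,
      δ * T / Real.log T ^ 2 < p → ((h / p + 1 : ℕ) : ℝ) ≤ growth h := by
  obtain ⟨T₁, hT₁⟩ := exists_mul_sq_log_le_growth 3 (2 / δ)
  refine ⟨max T₁ (max 2 (((16 / δ) ^ 3) ^ 2)), fun T hT h hh hhT p hp ↦ ?_⟩
  simp only [max_le_iff] at hT
  obtain ⟨hT1, hT2, hT3⟩ := hT
  have hT0 : 0 < T := by linarith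
  have hlog : 0 < Real.log T := Real.log_pos (by linarith)
  have hp0 : (0 : ℝ) < p := lt_trans (by positivity) hp
  rcases lt_or_ge h p with hlt | hge
  · rw [Nat.div_eq_of_lt hlt]
    simpa using one_le_growth hh
  rw [div_lt_iff₀ (by positivity)] at hp
  have hge' : (p : ℝ) ≤ h := by exact_mod_cast hge
  have e3 := sq_log_le_sqrt (L := T) (by linarith)
  have e5 : √T * √T = T := Real.mul_self_sqrt (by positivity)
  have hs : 0 < √T := by positivity
  have e6 : (16 / δ) ^ 3 ≤ √T := Real.le_sqrt_of_sq_le hT3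
  have e7 : δ * √T ≤ 16 * h := by
    refine le_of_mul_le_mul_right ?_ hs
    calc δ * √T * √T = δ * T := by rw [mul_assoc, e5]
      _ ≤ p * Real.log T ^ 2 := hp.le
      _ ≤ h * (16 * √T) := by gcongr
      _ = _ := by ring
  have hA : T ≤ (h : ℝ) ^ 3 := by
    have : √T ≤ 16 / δ * h := by
      rw [div_mul_eq_mul_div, le_div_iff₀ hδ]
      linarith
    have h3 : √T ^ 3 ≤ (16 / δ) ^ 3 * h ^ 3 := by
      rw [← mul_pow]
      gcongr
    have h4 : √T ^ 3 ≤ √T * h ^ 3 := h3.trans (by gcongr)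
    refine le_of_mul_le_mul_left ?_ hs
    calc √T * T = √T ^ 3 := by rw [pow_succ, pow_two, e5, mul_comm]
      _ ≤ _ := h4
  refine le_trans ?_ (hT₁ T hT1 h hh hA)
  have h5 : ((h / p : ℕ) : ℝ) ≤ h / p := Nat.cast_div_le
  have h6 : (1 : ℝ) ≤ h / p := by rw [le_div_iff₀ hp0]; linarith
  push_cast
  calc ((h / p : ℕ) : ℝ) + 1 ≤ 2 * (h / p) := by linarith
    _ = 2 * h / p := by ring
    _ ≤ 2 / δ * Real.log T ^ 2 := by
      rw [div_le_iff₀ hp0, div_mul_eq_mul_div, div_mul_eq_mul_div, le_div_iff₀ hδ]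
      nlinarith

lemma ncard_solutions (n p h : ℕ) (s : ZMod p) :
    Set.ncard {xy : (Fin n → ℤ) × (Fin n → ℤ) |
      (∀ i, 1 ≤ xy.1 i ∧ xy.1 i ≤ (h : ℤ)) ∧
      (∀ i, 1 ≤ xy.2 i ∧ xy.2 i ≤ (h : ℤ)) ∧
      (∏ i, ((xy.1 i : ZMod p) + s)) = (∏ i, ((xy.2 i : ZMod p) + s)) ∧
      (∏ i, ((xy.1 i : ZMod p) + s)) ≠ 0} = (solutions n p h s).card := by
  rw [← Set.ncard_coe_finset]
  congr 1
  ext xy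
  simp only [solutions, Finset.coe_filter, Finset.mem_product, mem_box, Set.mem_ofPred_eq,
    and_assoc]

lemma rpow_mul_rpow_eq {n h : ℕ} (hh : 0 < h) {T : ℝ} (hT : 0 < T) :
    (h : ℝ) ^ ((2 * n : ℝ) - 1 / 2) * T ^ (-(1 / 2) : ℝ) =
      (h : ℝ) ^ (2 * n) * (√(h * T))⁻¹ := by
  have hh0 : (0 : ℝ) < h := by exact_mod_cast hh
  rw [Real.rpow_sub hh0, Real.rpow_neg hT.le, ← Real.sqrt_eq_rpow, ← Real.sqrt_eq_rpow,
    Real.sqrt_mul hh0.le, mul_inv]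
  have : (h : ℝ) ^ (2 * n : ℝ) = (h : ℝ) ^ (2 * n) := by
    rw [← Real.rpow_natCast]
    push_cast
    rfl
  rw [this, div_eq_mul_inv, mul_assoc]

/-- For fixed `ν ≥ 1`, there is `C > 0` such that for every `ε > 0` there is `T₀`
so that for all `T ≥ T₀` and all integers `3 ≤ h < T`, the number of primes `p ≤ T` admitting
some `s ∈ 𝔽_p` with `K_ν(p,h,s) > (h^ν + h^{2ν-1/2} T^{-1/2}) exp(C log h / log log h)` is at
most `ε T / (log T)^2`. -/
theorem stmt0 (ν : ℕ) (hν : 1 ≤ ν) :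
    ∃ C : ℝ, 0 < C ∧ ∀ ε : ℝ, 0 < ε → ∃ T₀ : ℝ, ∀ T : ℝ, T₀ ≤ T →
      ∀ h : ℕ, 3 ≤ h → (h : ℝ) < T →
      (Set.ncard {p : ℕ | p.Prime ∧ (p : ℝ) ≤ T ∧ ∃ s : ZMod p,
          ((Set.ncard {xy : (Fin ν → ℤ) × (Fin ν → ℤ) |
              (∀ i, 1 ≤ xy.1 i ∧ xy.1 i ≤ (h : ℤ)) ∧
              (∀ i, 1 ≤ xy.2 i ∧ xy.2 i ≤ (h : ℤ)) ∧
              (∏ i, ((xy.1 i : ZMod p) + s)) = (∏ i, ((xy.2 i : ZMod p) + s)) ∧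
              (∏ i, ((xy.1 i : ZMod p) + s)) ≠ 0} : ℝ) >
            ((h : ℝ) ^ ν + (h : ℝ) ^ ((2 * ν : ℝ) - 1 / 2) * T ^ (-(1 / 2) : ℝ)) *
              Real.exp (C * Real.log h / Real.log (Real.log h)))} : ℝ)
        ≤ ε * T / (Real.log T) ^ 2 := by
  classical
  have hex : ∀ n : ℕ, ∃ E : ℕ, 0 < n → ∀ δ : ℝ, 0 < δ → ∃ T₀ : ℝ, ∀ T : ℝ, T₀ ≤ T →
      ∀ h : ℕ, 3 ≤ h → ∀ P : Finset ℕ, (∀ p ∈ P, p.Prime) →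
      ((P.filter fun p ↦ (h : ℝ) ^ (4 * n) * growth h ^ E / T <
        ((degenerate n p (2 * h)).card : ℝ)).card : ℝ) ≤ δ * T / Real.log T ^ 2 := by
    intro n
    rcases Nat.eq_zero_or_pos n with rfl | hn
    · exact ⟨0, fun h ↦ absurd h (lt_irrefl 0)⟩
    · obtain ⟨E, hE⟩ := exists_card_filter_degenerate_le_div_sq_log hn
      refine ⟨E, fun _ δ hδ ↦ ?_⟩
      obtain ⟨T₀, hT₀⟩ := hE δ hδ
      refine ⟨T₀, fun T hT h hh P hP ↦ le_trans (le_of_eq ?_) (hT₀ T hT h hh P hP)⟩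
      congr
  choose E hE using hex
  obtain ⟨D, hD⟩ := exists_card_solutions_le E ν
  refine ⟨D + 1, by positivity, fun ε hε ↦ ?_⟩
  set δ := ε / (ν + 1) with hδdef
  have hδ : 0 < δ := by positivity
  have hEδ : ∀ n : ℕ, ∃ T₀ : ℝ, 0 < n → ∀ T : ℝ, T₀ ≤ T →
      ∀ h : ℕ, 3 ≤ h → ∀ P : Finset ℕ, (∀ p ∈ P, p.Prime) →
      ((P.filter fun p ↦ (h : ℝ) ^ (4 * n) * growth h ^ E n / T <
        ((degenerate n p (2 * h)).card : ℝ)).card : ℝ) ≤ δ * T / Real.log T ^ 2 := by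
    intro n
    rcases Nat.eq_zero_or_pos n with rfl | hn
    · exact ⟨0, fun h ↦ absurd h (lt_irrefl 0)⟩
    · exact (hE n hn δ hδ).imp fun T₀ hT₀ _ ↦ hT₀
  choose τ hτ using hEδ
  obtain ⟨T₁, hT₁⟩ := exists_div_add_one_le_growth hδ
  obtain ⟨T₂, hT₂⟩ := ((Finset.range (ν + 1)).image τ).bddAbove
  refine ⟨max T₁ T₂, fun T hT h hh hhT ↦ ?_⟩
  rw [max_le_iff] at hT
  have hT0 : 0 < T := lt_of_le_of_lt (by positivity) hhT
  set X := δ * T / Real.log T ^ 2 with hX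
  have hX0 : 0 ≤ X := by positivity
  set P := (Finset.range (⌊T⌋₊ + 1)).filter Nat.Prime with hP
  have hPp : ∀ p ∈ P, p.Prime := fun p hp ↦ (Finset.mem_filter.mp hp).2
  set B : ℕ → Finset ℕ := fun n ↦ P.filter fun p ↦
    (h : ℝ) ^ (4 * n) * growth h ^ E n / T < ((degenerate n p (2 * h)).card : ℝ) with hB
  set S := Finset.Icc 1 ⌊X⌋₊ ∪ (Finset.Icc 1 ν).biUnion B with hS
  have hcardS : (S.card : ℝ) ≤ X + ν * X := by
    have h1 : (S.card : ℝ) ≤ (Finset.Icc 1 ⌊X⌋₊).card + ((Finset.Icc 1 ν).biUnion B).card := by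
      exact_mod_cast Finset.card_union_le _ _
    have h2 : (((Finset.Icc 1 ν).biUnion B).card : ℝ) ≤ ∑ n ∈ Finset.Icc 1 ν, ((B n).card : ℝ) := by
      exact_mod_cast Finset.card_biUnion_le
    have h3 : ∑ n ∈ Finset.Icc 1 ν, ((B n).card : ℝ) ≤ (Finset.Icc 1 ν).card • X := by
      refine Finset.sum_le_card_nsmul _ _ _ fun n hn ↦ ?_
      rw [Finset.mem_Icc] at hn
      refine hτ n (by omega) T (le_trans ?_ hT.2) h hh P hPp
      exact hT₂ (Finset.mem_coe.mpr
        (Finset.mem_image_of_mem τ (Finset.mem_range.mpr (by omega))))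
    rw [Nat.card_Icc, Nat.add_sub_cancel] at h1
    rw [Nat.card_Icc, Nat.add_sub_cancel, nsmul_eq_mul] at h3
    have := Nat.floor_le hX0
    linarith
  have hεX : X + ν * X = ε * T / Real.log T ^ 2 := by
    rw [hX, hδdef]
    field_simp
    ring
  rw [← hεX]
  refine le_trans ?_ hcardS
  rw [Nat.cast_le, ← Set.ncard_coe_finset]
  refine Set.ncard_le_ncard ?_ (Finset.finite_toSet _)
  rintro p ⟨hp, hpT, s, hs⟩
  rw [Finset.mem_coe]
  by_contra hpS
  simp only [hS, Finset.mem_union, Finset.mem_biUnion, Finset.mem_Icc, not_or, not_exists, not_and,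
    not_le] at hpS
  obtain ⟨hp1, hp2⟩ := hpS
  have hpX : X < p := (Nat.floor_lt hX0).mp (hp1 hp.one_le)
  have hpP : p ∈ P := Finset.mem_filter.mpr
    ⟨Finset.mem_range.mpr (Nat.lt_succ_of_le (Nat.le_floor hpT)), hp⟩
  have hle := hD h hh T hT0 p hp (hT₁ T hT.1 h hh hhT p hpX) (fun m h1 h2 ↦ by
    have := hp2 m ⟨h1, h2⟩
    simpa only [hB, Finset.mem_filter, hpP, true_and, not_lt] using this) s
  rw [ncard_solutions, rpow_mul_rpow_eq (by omega) hT0] at hs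
  refine absurd hs (not_lt.mpr (hle.trans ?_))
  rw [mul_comm]
  gcongr
  rw [growth_pow, Real.exp_le_exp, mul_div_assoc]
  have hl := loglog_pos hh
  have hL := one_lt_log_of_three_le hh
  gcongr
  linarith
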